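/- arXiv:1807.05322 — 4 statements merged into one kernel-verified Lean document; each statement's English description precedes it below -/
import Mathlib

section
/- Let G be a connected split graph with vertex partition into a clique K and an independent set I, let c ≥ 2, and let S, T be c-colorable subsets of V(G) with |S| = |T|, |S ∩ K| ≤ c−1 and |T ∩ K| ≤ c−1. Then T is c-reachable from S under token sliding. -/
open SimpleGraph

/-- A single token-sliding (TS) move from `S` to `T`: the sets have the same size,
`T ∖ S = {u}`, `S ∖ T = {v}`, and `uv` is an edge of `G`. -/
def TSMove {V : Type*} (G : SimpleGraph V) (S T : Set V) : Prop :=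
  S.ncard = T.ncard ∧ ∃ u v : V, G.Adj u v ∧ T \ S = {u} ∧ S \ T = {v}

/-- `S` is `c`-colorable: the subgraph induced by `S` admits a proper `c`-coloring. -/
def CColorable {V : Type*} (G : SimpleGraph V) (c : ℕ) (S : Set V) : Prop :=
  (G.induce S).Colorable c

/-- One TS step between `c`-colorable sets. -/
def TSStep {V : Type*} (G : SimpleGraph V) (c : ℕ) (S T : Set V) : Prop :=
  CColorable G c S ∧ CColorable G c T ∧ TSMove G S T

/-- `T` is `c`-reachable from `S` under token sliding: there is a sequence of
`c`-colorable sets from `S` to `T` with consecutive sets related by one TS move. -/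
def TSReachable {V : Type*} (G : SimpleGraph V) (c : ℕ) : Set V → Set V → Prop :=
  Relation.ReflTransGen (TSStep G c)

/-- `S` is an independent set of `G`. -/
def IsIndep {V : Type*} (G : SimpleGraph V) (S : Set V) : Prop :=
  S.Pairwise fun u v => ¬ G.Adj u v

section TokenSliding

variable {V : Type*}

/-- The set obtained from `S` by moving the token on `x` to `y`. -/
def moveToken (S : Set V) (x y : V) : Set V := insert y (S \ {x})

theorem mem_moveToken {S : Set V} {x y z : V} :
    z ∈ moveToken S x y ↔ z = y ∨ (z ∈ S ∧ z ≠ x) := by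
  simp [moveToken]

theorem moveToken_moveToken {S : Set V} {x y z : V} (hy : y ∉ S) :
    moveToken (moveToken S x y) y z = moveToken S x z := by
  ext w
  simp only [mem_moveToken]
  grind

theorem moveToken_moveToken_of_mem {S : Set V} {x y z : V} (hy : y ∈ S) (hxy : x ≠ y)
    (hz : z ∉ S) (hx : x ∈ S) :
    moveToken (moveToken S y z) x y = moveToken S x z := by
  ext w
  simp only [mem_moveToken]
  grind

theorem moveToken_self_inverse {S : Set V} {x y : V} (hx : x ∈ S) (hy : y ∉ S) :
    moveToken (moveToken S x y) y x = S := by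
  ext w
  simp only [mem_moveToken]
  grind

theorem ncard_moveToken [Finite V] {S : Set V} {x y : V} (hx : x ∈ S) (hy : y ∉ S) :
    (moveToken S x y).ncard = S.ncard :=
  Set.ncard_exchange hy hx

theorem moveToken_inter_subset (S K : Set V) (x y : V) :
    moveToken S x y ∩ K ⊆ insert y ((S ∩ K) \ {x}) := by
  intro w
  simp only [Set.mem_inter_iff, mem_moveToken, Set.mem_insert_iff, Set.mem_sdiff,
    Set.mem_singleton_iff]
  tauto

theorem ncard_moveToken_inter_le_of_mem [Finite V] {S K : Set V} {x : V} (y : V)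
    (hx : x ∈ S ∩ K) : (moveToken S x y ∩ K).ncard ≤ (S ∩ K).ncard :=
  calc
    (moveToken S x y ∩ K).ncard ≤ (insert y ((S ∩ K) \ {x})).ncard :=
      Set.ncard_le_ncard (moveToken_inter_subset S K x y)
    _ ≤ ((S ∩ K) \ {x}).ncard + 1 := Set.ncard_insert_le _ _
    _ = (S ∩ K).ncard := Set.ncard_sdiff_singleton_add_one hx

theorem ncard_moveToken_inter_le_of_notMem [Finite V] {S K : Set V} (x : V) {y : V}
    (hy : y ∉ K) : (moveToken S x y ∩ K).ncard ≤ (S ∩ K).ncard := by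
  refine Set.ncard_le_ncard fun w => ?_
  simp only [Set.mem_inter_iff, mem_moveToken]
  grind

theorem ncard_moveToken_inter_le_add_one [Finite V] (S K : Set V) (x y : V) :
    (moveToken S x y ∩ K).ncard ≤ (S ∩ K).ncard + 1 :=
  calc
    (moveToken S x y ∩ K).ncard ≤ (insert y ((S ∩ K) \ {x})).ncard :=
      Set.ncard_le_ncard (moveToken_inter_subset S K x y)
    _ ≤ ((S ∩ K) \ {x}).ncard + 1 := Set.ncard_insert_le _ _
    _ ≤ (S ∩ K).ncard + 1 := Nat.add_le_add_right (Set.ncard_le_ncard Set.sdiff_subset) 1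

variable {G : SimpleGraph V} {K I : Set V} {c : ℕ}

theorem cColorable_of_ncard_inter_lt [Finite V] (hpart : K ∪ I = Set.univ)
    (hI : IsIndep G I) {S : Set V} (hS : (S ∩ K).ncard < c) : CColorable G c S := by
  classical
  have := Fintype.ofFinite ↥(S ∩ K)
  let C : (G.induce S).Coloring (Option ↥(S ∩ K)) :=
    SimpleGraph.Coloring.mk (fun v => if h : v.1 ∈ K then some ⟨v.1, v.2, h⟩ else none) (by
      rintro ⟨v, hv⟩ ⟨w, hw⟩ hvw
      have hadj : G.Adj v w := hvw
      have hne : v ≠ w := hadj.ne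
      by_cases h1 : v ∈ K <;> by_cases h2 : w ∈ K <;> simp only [h1, h2, dite_true, dite_false]
      · exact fun h => hne (congrArg Subtype.val (Option.some.inj h))
      · exact Option.some_ne_none _
      · exact (Option.some_ne_none _).symm
      have hv' : v ∈ I := (hpart ▸ Set.mem_univ v : v ∈ K ∪ I).resolve_left h1
      have hw' : w ∈ I := (hpart ▸ Set.mem_univ w : w ∈ K ∪ I).resolve_left h2
      exact (hI hv' hw' hne hadj).elim)
  refine C.colorable.mono ?_
  rw [Fintype.card_option, ← Nat.card_eq_fintype_card, Nat.card_coe_set_eq]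
  exact hS

theorem TSMove.symm {S T : Set V} (h : TSMove G S T) : TSMove G T S := by
  obtain ⟨hcard, u, v, huv, hu, hv⟩ := h
  exact ⟨hcard.symm, v, u, huv.symm, hv, hu⟩

theorem TSReachable.symm {S T : Set V} (h : TSReachable G c S T) : TSReachable G c T S :=
  have : Std.Symm (TSStep G c) := ⟨fun _ _ h => ⟨h.2.1, h.1, h.2.2.symm⟩⟩
  Relation.ReflTransGen.stdSymm.symm _ _ h

theorem tsMove_moveToken [Finite V] {S : Set V} {x y : V} (hx : x ∈ S) (hy : y ∉ S)
    (hxy : G.Adj x y) : TSMove G S (moveToken S x y) := by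
  refine ⟨(ncard_moveToken hx hy).symm, y, x, hxy.symm, ?_, ?_⟩ <;> ext w <;>
    simp only [Set.mem_sdiff, mem_moveToken, Set.mem_singleton_iff] <;> grind

theorem tsReachable_moveToken_of_adj [Finite V] (hpart : K ∪ I = Set.univ)
    (hI : IsIndep G I) {S : Set V} {x y : V} (hx : x ∈ S) (hy : y ∉ S) (hxy : G.Adj x y)
    (hS : (S ∩ K).ncard < c) (hS' : (moveToken S x y ∩ K).ncard < c) :
    TSReachable G c S (moveToken S x y) :=
  .single ⟨cColorable_of_ncard_inter_lt hpart hI hS, cColorable_of_ncard_inter_lt hpart hI hS',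
    tsMove_moveToken hx hy hxy⟩

theorem exists_adj_mem_of_isIndep (hpart : K ∪ I = Set.univ) (hI : IsIndep G I)
    (hconn : G.Connected) {i j : V} (hi : i ∈ I) (hij : i ≠ j) : ∃ k ∈ K, G.Adj i k := by
  have : Nontrivial V := ⟨i, j, hij⟩
  obtain ⟨k, hk⟩ := hconn.preconnected.exists_adj_of_nontrivial i
  refine ⟨k, (hpart ▸ Set.mem_univ k : k ∈ K ∪ I).resolve_right fun hkI => ?_, hk⟩
  exact hI hi hkI hk.ne hk

theorem tsReachable_moveToken_clique_indep [Finite V] (hpart : K ∪ I = Set.univ)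
    (hK : G.IsClique K) (hI : IsIndep G I) (hconn : G.Connected) {S : Set V} {a j : V}
    (ha : a ∈ S) (haK : a ∈ K) (hj : j ∉ S) (hjI : j ∈ I) (hS : (S ∩ K).ncard < c) :
    TSReachable G c S (moveToken S a j) := by
  obtain ⟨k, hk, hjk⟩ := exists_adj_mem_of_isIndep hpart hI hconn hjI (j := a) (by grind)
  rcases eq_or_ne a k with rfl | hak
  · exact tsReachable_moveToken_of_adj hpart hI ha hj hjk.symm hS
      ((ncard_moveToken_inter_le_of_mem j ⟨ha, haK⟩).trans_lt hS)
  have hjk' : j ≠ k := hjk.ne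
  by_cases hkS : k ∈ S
  · have h1 : (moveToken S k j ∩ K).ncard < c :=
      (ncard_moveToken_inter_le_of_mem j ⟨hkS, hk⟩).trans_lt hS
    have ha1 : a ∈ moveToken S k j := mem_moveToken.2 (.inr ⟨ha, hak⟩)
    rw [← moveToken_moveToken_of_mem hkS hak hj ha]
    refine (tsReachable_moveToken_of_adj hpart hI hkS hj hjk.symm hS h1).trans
      (tsReachable_moveToken_of_adj hpart hI ha1 ?_ (hK haK hk hak) h1
        ((ncard_moveToken_inter_le_of_mem k ⟨ha1, haK⟩).trans_lt h1))
    rw [mem_moveToken]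
    grind
  · have h1 : (moveToken S a k ∩ K).ncard < c :=
      (ncard_moveToken_inter_le_of_mem k ⟨ha, haK⟩).trans_lt hS
    have hk1 : k ∈ moveToken S a k := mem_moveToken.2 (.inl rfl)
    rw [← moveToken_moveToken hkS]
    refine (tsReachable_moveToken_of_adj hpart hI ha hkS (hK haK hk hak) hS h1).trans
      (tsReachable_moveToken_of_adj hpart hI hk1 ?_ hjk.symm h1
        ((ncard_moveToken_inter_le_of_mem j ⟨hk1, hk⟩).trans_lt h1))
    rw [mem_moveToken]
    grind

theorem tsReachable_moveToken_indep_clique [Finite V] (hpart : K ∪ I = Set.univ)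
    (hK : G.IsClique K) (hI : IsIndep G I) (hconn : G.Connected) {S : Set V} {i a : V}
    (hi : i ∈ S) (hiI : i ∈ I) (ha : a ∉ S) (haK : a ∈ K)
    (hS' : (moveToken S i a ∩ K).ncard < c) :
    TSReachable G c S (moveToken S i a) := by
  have h := tsReachable_moveToken_clique_indep hpart hK hI hconn (j := i)
    (mem_moveToken.2 (.inl rfl)) haK (by rw [mem_moveToken]; grind) hiI hS'
  rw [moveToken_self_inverse hi ha] at h
  exact h.symm

theorem tsReachable_moveToken_indep_indep [Finite V] (hpart : K ∪ I = Set.univ)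
    (hdisj : Disjoint K I) (hK : G.IsClique K) (hI : IsIndep G I) (hconn : G.Connected)
    (hc : 2 ≤ c) {S : Set V} {i j : V} (hi : i ∈ S) (hiI : i ∈ I) (hj : j ∉ S)
    (hjI : j ∈ I) (hS : (S ∩ K).ncard < c) :
    TSReachable G c S (moveToken S i j) := by
  have hiK : i ∉ K := fun h => Set.disjoint_left.1 hdisj h hiI
  have hjK : j ∉ K := fun h => Set.disjoint_left.1 hdisj h hjI
  rcases (S ∩ K).eq_empty_or_nonempty with hemp | ⟨a, haS, haK⟩
  · obtain ⟨k, hk, -⟩ := exists_adj_mem_of_isIndep hpart hI hconn hiI (j := j) (by grind)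
    have hkS : k ∉ S := fun h => (hemp ▸ (⟨h, hk⟩ : k ∈ S ∩ K) : k ∈ (∅ : Set V))
    have h1 : (moveToken S i k ∩ K).ncard < c := by
      have := ncard_moveToken_inter_le_add_one S K i k
      rw [hemp, Set.ncard_empty] at this
      omega
    rw [← moveToken_moveToken hkS]
    refine (tsReachable_moveToken_indep_clique hpart hK hI hconn hi hiI hkS hk h1).trans
      (tsReachable_moveToken_clique_indep hpart hK hI hconn (mem_moveToken.2 (.inl rfl)) hk
        ?_ hjI h1)
    rw [mem_moveToken]
    grind
  · have hia : i ≠ a := by grind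
    rw [← moveToken_moveToken_of_mem haS hia hj hi]
    refine (tsReachable_moveToken_clique_indep hpart hK hI hconn haS haK hj hjI hS).trans
      (tsReachable_moveToken_indep_clique hpart hK hI hconn
        (mem_moveToken.2 (.inr ⟨hi, hia⟩)) hiI ?_ haK ?_)
    · rw [mem_moveToken]
      grind
    · rw [moveToken_moveToken_of_mem haS hia hj hi]
      exact (ncard_moveToken_inter_le_of_notMem i hjK).trans_lt hS

theorem tsReachable_moveToken [Finite V] (hpart : K ∪ I = Set.univ)
    (hdisj : Disjoint K I) (hK : G.IsClique K) (hI : IsIndep G I) (hconn : G.Connected)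
    (hc : 2 ≤ c) {S : Set V} {x y : V} (hx : x ∈ S) (hy : y ∉ S)
    (hS : (S ∩ K).ncard < c) (hS' : (moveToken S x y ∩ K).ncard < c) :
    TSReachable G c S (moveToken S x y) := by
  rcases (hpart ▸ Set.mem_univ x : x ∈ K ∪ I) with hxK | hxI <;>
    rcases (hpart ▸ Set.mem_univ y : y ∈ K ∪ I) with hyK | hyI
  · exact tsReachable_moveToken_of_adj hpart hI hx hy (hK hxK hyK (by grind)) hS hS'
  · exact tsReachable_moveToken_clique_indep hpart hK hI hconn hx hxK hy hyI hS
  · exact tsReachable_moveToken_indep_clique hpart hK hI hconn hx hxI hy hyK hS'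
  · exact tsReachable_moveToken_indep_indep hpart hdisj hK hI hconn hc hx hxI hy hyI hS

theorem exists_moveToken_inter_lt [Finite V] {S T : Set V}
    (hST : S.ncard = T.ncard) (hne : S ≠ T) (hS : (S ∩ K).ncard < c)
    (hT : (T ∩ K).ncard < c) :
    ∃ x ∈ S \ T, ∃ y ∈ T \ S, (moveToken S x y ∩ K).ncard < c := by
  obtain ⟨x, hx⟩ : (S \ T).Nonempty :=
    Set.sdiff_nonempty.2 fun h => hne (Set.eq_of_subset_of_ncard_le h hST.ge)
  obtain ⟨y, hy⟩ : (T \ S).Nonempty :=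
    Set.sdiff_nonempty.2 fun h => hne (Set.eq_of_subset_of_ncard_le h hST.le).symm
  by_cases h1 : ∃ a ∈ S \ T, a ∈ K
  · obtain ⟨a, ha, haK⟩ := h1
    exact ⟨a, ha, y, hy, (ncard_moveToken_inter_le_of_mem y ⟨ha.1, haK⟩).trans_lt hS⟩
  by_cases hyK : y ∈ K
  · refine ⟨x, hx, y, hy, (ncard_moveToken_inter_le_add_one S K x y).trans_lt ?_⟩
    have hlt : (S ∩ K).ncard < (T ∩ K).ncard := by
      refine Set.ncard_lt_ncard (Set.ssubset_iff_exists.2 ⟨fun w hw => ?_, y, ?_, ?_⟩) <;> grind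
    omega
  · exact ⟨x, hx, y, hy, (ncard_moveToken_inter_le_of_notMem x hyK).trans_lt hS⟩

end TokenSliding

/-- Lemma: on a connected split graph (clique `K`, independent set `I`), for `c ≥ 2`,
any two `c`-colorable sets of the same size with at most `c - 1` vertices in the
clique are mutually `c`-reachable under token sliding. -/
theorem stmt0 {V : Type*} [Fintype V] (G : SimpleGraph V) (K I : Set V)
    (hpart : K ∪ I = Set.univ) (hdisj : Disjoint K I)
    (hK : G.IsClique K) (hI : IsIndep G I) (hconn : G.Connected)
    (c : ℕ) (hc : 2 ≤ c) (S T : Set V)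
    (hS : CColorable G c S) (hT : CColorable G c T) (hST : S.ncard = T.ncard)
    (hSK : (S ∩ K).ncard ≤ c - 1) (hTK : (T ∩ K).ncard ≤ c - 1) :
    TSReachable G c S T := by
  have hTK' : (T ∩ K).ncard < c := by omega
  have hSK' : (S ∩ K).ncard < c := by omega
  clear hS hT hSK hTK
  induction hn : (S \ T).ncard using Nat.strong_induction_on generalizing S with
  | _ n ih =>
    by_cases hne : S = T
    · exact hne ▸ .refl
    obtain ⟨x, hx, y, hy, hxy⟩ := exists_moveToken_inter_lt hST hne hSK' hTK'
    refine (tsReachable_moveToken hpart hdisj hK hI hconn hc hx.1 hy.2 hSK' hxy).trans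
      (ih _ ?_ _ ((ncard_moveToken hx.1 hy.2).trans hST) hxy rfl)
    rw [← hn]
    refine Set.ncard_lt_ncard (Set.ssubset_iff_exists.2 ⟨fun w hw => ?_, x, hx, ?_⟩)
    · simp only [Set.mem_sdiff, mem_moveToken] at hw ⊢
      grind
    · simp only [Set.mem_sdiff, mem_moveToken]
      grind
end

section
/- Let G be a split graph with vertex partition into a clique K and an independent set I, let c ≥ 2, and let S, T be c-colorable subsets of V(G) with |S| = |T|, |S ∩ K| ≤ c−1, |T ∩ K| ≤ c−1, and S ∩ I = T ∩ I. Then S can be c-transformed into T under token sliding by a sequence of exactly |S∖T| TS moves. -/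
open SimpleGraph

/-- `TSSteps G c n S T`: `S` can be `c`-transformed into `T` by a sequence of
exactly `n` TS moves (through `c`-colorable sets). -/
def TSSteps {V : Type*} (G : SimpleGraph V) (c : ℕ) : ℕ → Set V → Set V → Prop
  | 0, S, T => S = T
  | n + 1, S, T => ∃ M, TSStep G c S M ∧ TSSteps G c n M T

/-- A set meeting the clique side in fewer than `c` vertices is `c`-colorable: one color is
reserved for the independent side. -/
theorem cColorable_of_ncard_inter_le {V : Type*} [Finite V] {G : SimpleGraph V} {K I : Set V}
    (hpart : K ∪ I = Set.univ) (hI : IsIndep G I) {c : ℕ} (hc : 1 ≤ c) {X : Set V}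
    (hX : (X ∩ K).ncard ≤ c - 1) : CColorable G c X := by
  classical
  have := Fintype.ofFinite V
  have hcard : Fintype.card ↥(X ∩ K) ≤ Fintype.card (Fin (c - 1)) := by
    rw [Fintype.card_fin, ← Nat.card_eq_fintype_card]
    exact hX
  obtain ⟨f⟩ := Function.Embedding.nonempty_of_card_le hcard
  have mem_I : ∀ v, v ∉ K → v ∈ I := fun v hv =>
    ((hpart ▸ Set.mem_univ v : v ∈ K ∪ I)).resolve_left hv
  let color : X → Option (Fin (c - 1)) := fun v =>
    if h : (v : V) ∈ K then some (f ⟨v, v.2, h⟩) else none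
  have hcolor : ∀ {v w : X}, (G.induce X).Adj v w → color v ≠ color w := by
    intro v w hvw
    have hadj : G.Adj v w := hvw
    by_cases hv : (v : V) ∈ K <;> by_cases hw : (w : V) ∈ K <;> simp only [color, hv, hw]
    · intro h
      have h' := f.injective (Option.some.inj h)
      exact hadj.ne (Subtype.mk.inj h')
    · simp
    · simp
    · exact fun _ => hI (mem_I v hv) (mem_I w hw) hadj.ne hadj
  have h := (Coloring.mk color hcolor).colorable
  rwa [Fintype.card_option, Fintype.card_fin, Nat.sub_add_cancel hc] at h

/-- Lemma: on a split graph (clique `K`, independent set `I`), for `c ≥ 2`, two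
`c`-colorable sets of the same size with at most `c - 1` clique vertices each and
with the same trace on `I` can be `c`-transformed into one another by exactly
`|S ∖ T|` token-sliding moves. -/
theorem stmt1 {V : Type*} [Fintype V] (G : SimpleGraph V) (K I : Set V)
    (hpart : K ∪ I = Set.univ) (hdisj : Disjoint K I)
    (hK : G.IsClique K) (hI : IsIndep G I)
    (c : ℕ) (hc : 2 ≤ c) (S T : Set V)
    (hS : CColorable G c S) (hT : CColorable G c T) (hST : S.ncard = T.ncard)
    (hSK : (S ∩ K).ncard ≤ c - 1) (hTK : (T ∩ K).ncard ≤ c - 1)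
    (hSI : S ∩ I = T ∩ I) :
    TSSteps G c ((S \ T).ncard) S T := by
  induction h : (S \ T).ncard generalizing S with
  | zero =>
    have hsub : S ⊆ T := Set.sdiff_eq_empty.mp ((Set.ncard_eq_zero).mp h)
    exact Set.eq_of_subset_of_ncard_le hsub hST.ge
  | succ n ih =>
    have mem_K : ∀ v, v ∉ I → v ∈ K := fun v hv =>
      ((hpart ▸ Set.mem_univ v : v ∈ K ∪ I)).resolve_right hv
    have hmem : ∀ x, x ∈ I → (x ∈ S ↔ x ∈ T) := fun x hx => by
      simpa [hx] using Set.ext_iff.mp hSI x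
    have hTS : (T \ S).ncard = n + 1 := by
      rw [← h]
      exact (Set.ncard_eq_ncard_iff_ncard_sdiff_eq_ncard_sdiff).mp hST.symm
    obtain ⟨v, hvS, hvT⟩ := Set.nonempty_of_ncard_ne_zero (h.trans_ne n.succ_ne_zero)
    obtain ⟨u, huT, huS⟩ := Set.nonempty_of_ncard_ne_zero (hTS.trans_ne n.succ_ne_zero)
    have hvI : v ∉ I := fun hv => hvT ((hmem v hv).mp hvS)
    have huI : u ∉ I := fun hu => huS ((hmem u hu).mpr huT)
    have hvK := mem_K v hvI
    have huK := mem_K u huI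
    have huv : u ≠ v := fun e => huS (e ▸ hvS)
    set M : Set V := insert u (S \ {v}) with hM
    have hMcard : M.ncard = S.ncard := Set.ncard_exchange huS hvS
    have hMK : (M ∩ K).ncard = (S ∩ K).ncard := by
      have e : M ∩ K = insert u ((S ∩ K) \ {v}) := by
        ext x; simp only [hM, Set.mem_inter_iff, Set.mem_insert_iff, Set.mem_sdiff,
          Set.mem_singleton_iff]; grind
      rw [e]
      exact Set.ncard_exchange (fun hu => huS hu.1) ⟨hvS, hvK⟩
    have hMI : M ∩ I = T ∩ I := by
      rw [← hSI]
      ext x; simp only [hM, Set.mem_inter_iff, Set.mem_insert_iff, Set.mem_sdiff,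
        Set.mem_singleton_iff]; grind
    have hMT : M \ T = (S \ T) \ {v} := by
      ext x; simp only [hM, Set.mem_insert_iff, Set.mem_sdiff, Set.mem_singleton_iff]; grind
    have hMcol : CColorable G c M :=
      cColorable_of_ncard_inter_le hpart hI (by omega) (hMK ▸ hSK)
    refine ⟨M, ⟨hS, hMcol, hMcard.symm, u, v, hK huK hvK huv, ?_, ?_⟩,
      ih M hMcol (hMcard.trans hST) (hMK ▸ hSK) hMI ?_⟩
    · ext x; simp only [hM, Set.mem_insert_iff, Set.mem_sdiff, Set.mem_singleton_iff]; grind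
    · ext x; simp only [hM, Set.mem_insert_iff, Set.mem_sdiff, Set.mem_singleton_iff]; grind
    · rw [hMT, Set.ncard_sdiff_singleton_of_mem (show v ∈ S \ T from ⟨hvS, hvT⟩), h, Nat.add_sub_cancel]
end

section
/- Let G be a split graph with vertex partition into a clique K and an independent set I, let c ≥ 1, and let I_0, I_1, …, I_ℓ be a sequence of c-colorable sets in which consecutive sets are related by one TS move, such that |I_j ∩ K| = c for every j ∈ {0, …, ℓ}. Then the sequence is rigid, i.e., I_j ∩ I = I_0 ∩ I for every j ∈ {0, …, ℓ}. -/
open SimpleGraph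

/-- If `S` and `T` differ by swapping adjacent vertices and meet `K` in equally many vertices,
then no vertex of the independent side `A` is lost in passing from `S` to `T`. -/
theorem inter_indep_subset_of_swap {V : Type*} [Finite V] {G : SimpleGraph V} {K A S T : Set V}
    (hpart : K ∪ A = Set.univ) (hdisj : Disjoint K A) (hA : IsIndep G A) {u v : V}
    (huv : G.Adj u v) (hTS : T \ S = {u}) (hST : S \ T = {v})
    (hcard : (S ∩ K).ncard = (T ∩ K).ncard) : S ∩ A ⊆ T ∩ A := by
  rintro x ⟨hxS, hxA⟩
  refine ⟨?_, hxA⟩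
  by_contra hxT
  obtain rfl : x = v := hST.subset ⟨hxS, hxT⟩
  obtain ⟨huT, huS⟩ : u ∈ T \ S := hTS.symm.subset rfl
  have huK : u ∈ K := by
    rcases hpart.symm.subset (Set.mem_univ u) with h | h
    · exact h
    · exact absurd huv (hA h hxA huv.ne)
  refine hcard.not_lt (Set.ncard_lt_ncard ⟨?_, fun h => huS (h ⟨huT, huK⟩).1⟩ (Set.toFinite _))
  rintro y ⟨hyS, hyK⟩
  refine ⟨?_, hyK⟩
  by_contra hyT
  obtain rfl : y = x := hST.subset ⟨hyS, hyT⟩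
  exact Set.disjoint_left.mp hdisj hyK hxA

/-- Lemma: on a split graph (clique `K`, independent set `A`), for `c ≥ 1`, a
sequence `I₀, …, I_ℓ` of `c`-colorable sets in which consecutive sets are related
by one TS move and every set has exactly `c` vertices in the clique is rigid:
every `I_j` has the same trace on the independent side `A` as `I₀`. -/
theorem stmt3 {V : Type*} [Fintype V] (G : SimpleGraph V) (K A : Set V)
    (hpart : K ∪ A = Set.univ) (hdisj : Disjoint K A)
    (hK : G.IsClique K) (hA : IsIndep G A)
    (c : ℕ) (hc : 1 ≤ c) (ℓ : ℕ) (Iseq : ℕ → Set V)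
    (hcol : ∀ j ≤ ℓ, CColorable G c (Iseq j))
    (hstep : ∀ j < ℓ, TSStep G c (Iseq j) (Iseq (j + 1)))
    (hKcard : ∀ j ≤ ℓ, (Iseq j ∩ K).ncard = c) :
    ∀ j ≤ ℓ, Iseq j ∩ A = Iseq 0 ∩ A := by
  intro j
  induction j with
  | zero => exact fun _ => rfl
  | succ j ih =>
    intro hj
    obtain ⟨-, -, -, u, v, huv, hTS, hST⟩ := hstep j hj
    have hcard : (Iseq j ∩ K).ncard = (Iseq (j + 1) ∩ K).ncard := by
      rw [hKcard j (by omega), hKcard (j + 1) hj]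
    rw [← ih (by omega)]
    exact (inter_indep_subset_of_swap hpart hdisj hA huv.symm hST hTS hcard.symm).antisymm
      (inter_indep_subset_of_swap hpart hdisj hA huv hTS hST hcard)
end

section
/- Let G be a graph, k ≥ 1, and let S, T be dominating sets of G with |S| = |T| = k − 1. Then the following are equivalent: (i) there is a sequence S = T_0, T_1, …, T_ℓ = T in which every T_j is a dominating set of G with |T_j| ≤ k and consecutive sets differ by adding or removing exactly one vertex (TAR moves with upper threshold k); (ii) there is a sequence S = R_0, R_1, …, R_{ℓ'} = T in which every R_j is a dominating set of G of size k − 1 and consecutive sets differ by a token jump (exchanging one vertex for another). -/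
open SimpleGraph

/-- A single token-jumping (TJ) move from `S` to `T`:
exchange one vertex for another. -/
def TJMove {α : Type*} (S T : Set α) : Prop :=
  S.ncard = T.ncard ∧ (T \ S).ncard = 1 ∧ (S \ T).ncard = 1

/-- A single token addition/removal (TAR) move: add or remove one vertex. -/
def TARMove {α : Type*} (S T : Set α) : Prop :=
  ((S \ T) ∪ (T \ S)).ncard = 1

/-- `S` is a dominating set of `G`: every vertex lies in the closed neighborhood
of some vertex of `S`. -/
def Dominating {α : Type*} (G : SimpleGraph α) (S : Set α) : Prop :=
  ∀ v : α, ∃ u ∈ S, u = v ∨ G.Adj u v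

theorem Dominating.mono {α : Type*} {G : SimpleGraph α} {A B : Set α}
    (hA : Dominating G A) (hAB : A ⊆ B) : Dominating G B := fun v =>
  let ⟨u, hu, h⟩ := hA v
  ⟨u, hAB hu, h⟩

theorem TARMove.eq_insert_or {α : Type*} {A B : Set α} (h : TARMove A B) :
    ∃ x, (x ∉ A ∧ B = insert x A) ∨ (x ∉ B ∧ A = insert x B) := by
  obtain ⟨x, hx⟩ := Set.ncard_eq_one.1 h
  have hmem : ∀ y, (y ∈ A ∧ y ∉ B) ∨ (y ∈ B ∧ y ∉ A) ↔ y = x := fun y => by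
    simpa using Set.ext_iff.1 hx y
  refine ⟨x, ?_⟩
  rcases (hmem x).2 rfl with ⟨hxA, hxB⟩ | ⟨hxB, hxA⟩
  · refine Or.inr ⟨hxB, Set.ext fun y => ?_⟩
    have := hmem y
    rw [Set.mem_insert_iff]
    grind
  · refine Or.inl ⟨hxA, Set.ext fun y => ?_⟩
    have := hmem y
    rw [Set.mem_insert_iff]
    grind

theorem tarMove_union_right {α : Type*} {A B : Set α} (h : (B \ A).ncard = 1) :
    TARMove A (A ∪ B) := by
  unfold TARMove
  rwa [Set.sdiff_eq_empty.2 Set.subset_union_left, Set.empty_union, Set.union_sdiff_left]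

theorem TARMove.symm {α : Type*} {A B : Set α} (h : TARMove A B) : TARMove B A := by
  unfold TARMove at *
  rwa [Set.union_comm]

/-- Two distinct `n`-subsets of an `(n + 1)`-set differ by a token jump. -/
theorem tjMove_of_subset {α : Type*} [Finite α] {A B C : Set α} {n : ℕ} (hA : A.ncard = n)
    (hB : B.ncard = n) (hC : C.ncard = n + 1) (hAC : A ⊆ C) (hBC : B ⊆ C) (hne : A ≠ B) :
    TJMove A B := by
  have hle : (A ∪ B).ncard ≤ n + 1 := hC ▸ Set.ncard_le_ncard (Set.union_subset hAC hBC)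
  have hlt : n < (A ∪ B).ncard := by
    by_contra! h
    have h₁ : A = A ∪ B := Set.eq_of_subset_of_ncard_le Set.subset_union_left (by omega)
    have h₂ : B = A ∪ B := Set.eq_of_subset_of_ncard_le Set.subset_union_right (by omega)
    exact hne (h₁.trans h₂.symm)
  have hAB : (A \ B).ncard + B.ncard = (A ∪ B).ncard := Set.ncard_sdiff_add_ncard A B
  have hBA : (B \ A).ncard + A.ncard = (B ∪ A).ncard := Set.ncard_sdiff_add_ncard B A
  rw [Set.union_comm] at hBA
  exact ⟨hA.trans hB.symm, by omega, by omega⟩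

/-- Theorem: for dominating sets `S`, `T` of size `k - 1`, the following are
equivalent: (i) `S` can be transformed into `T` by TAR moves through dominating
sets of size at most `k`; (ii) `S` can be transformed into `T` by token jumps
through dominating sets of size `k - 1`. -/
theorem stmt18 {α : Type*} [Fintype α] (G : SimpleGraph α) (k : ℕ) (hk : 1 ≤ k)
    (S T : Set α) (hS : Dominating G S) (hT : Dominating G T)
    (hSk : S.ncard = k - 1) (hTk : T.ncard = k - 1) :
    Relation.ReflTransGen (fun A B : Set α =>
        Dominating G A ∧ Dominating G B ∧ A.ncard ≤ k ∧ B.ncard ≤ k ∧ TARMove A B)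
      S T ↔
    Relation.ReflTransGen (fun A B : Set α =>
        Dominating G A ∧ Dominating G B ∧ A.ncard = k - 1 ∧ B.ncard = k - 1 ∧
        TJMove A B) S T := by
  constructor
  · intro h
    suffices key : ∀ B, Dominating G B → B.ncard = k - 1 → T ⊆ B ∨ B ⊆ T →
        Relation.ReflTransGen (fun A B : Set α =>
          Dominating G A ∧ Dominating G B ∧ A.ncard = k - 1 ∧ B.ncard = k - 1 ∧
          TJMove A B) S B from key T hT hTk (Or.inl subset_rfl)
    clear hT hTk
    induction h with
    | refl =>
      rintro B - hBk (h | h)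
      · rw [← Set.eq_of_subset_of_ncard_le h (by omega)]
      · rw [Set.eq_of_subset_of_ncard_le h (by omega)]
    | @tail A A' _ hstep ih =>
      obtain ⟨hA, hA', hAk, hAk', hmove⟩ := hstep
      intro B hB hBk hcomp
      obtain ⟨x, ⟨hx, rfl⟩ | ⟨hx, rfl⟩⟩ := hmove.eq_insert_or
      · rcases hcomp with h | h
        · exact ih B hB hBk (Or.inl ((Set.subset_insert x A).trans h))
        have hcard := Set.ncard_insert_of_notMem hx
        have hle := Set.ncard_le_ncard h
        by_cases hAk₁ : A.ncard = k - 1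
        · have hSA := ih A hA hAk₁ (Or.inl subset_rfl)
          by_cases hne : A = B
          · exact hne ▸ hSA
          · exact hSA.tail ⟨hA, hB, hAk₁, hBk, tjMove_of_subset hAk₁ hBk (by omega)
              (Set.subset_insert x A) h hne⟩
        · have hBA : B = insert x A := Set.eq_of_subset_of_ncard_le h (by omega)
          exact ih B hB hBk (Or.inl (hBA ▸ Set.subset_insert x A))
      · rcases hcomp with h | h
        swap
        · exact ih B hB hBk (Or.inr (h.trans (Set.subset_insert x A')))
        have hcard := Set.ncard_insert_of_notMem hx
        have hle := Set.ncard_le_ncard h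
        by_cases hxB : x ∈ B
        · exact ih B hB hBk (Or.inl (Set.insert_subset hxB h))
        by_cases hlt : A'.ncard < B.ncard
        · obtain ⟨y, hyB, hyA⟩ := Set.exists_mem_notMem_of_ncard_lt_ncard hlt
          have hsub : insert x A' ⊆ insert x (B \ {y}) :=
            Set.insert_subset_insert (Set.subset_sdiff_singleton h hyA)
          have hDk : (insert x (B \ {y})).ncard = k - 1 := by
            rw [Set.ncard_exchange hxB hyB, hBk]
          have hD := hA.mono hsub
          refine (ih _ hD hDk (Or.inl hsub)).tail ⟨hD, hB, hDk, hBk,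
            tjMove_of_subset hDk hBk (C := insert x B) ?_
              (Set.insert_subset_insert Set.sdiff_subset) (Set.subset_insert x B) ?_⟩
          · rw [Set.ncard_insert_of_notMem hxB, hBk]
          · exact fun he => hxB (he ▸ Set.mem_insert x _)
        · rw [← Set.eq_of_subset_of_ncard_le h (by omega)] at hB hBk ⊢
          exact ih A' hB hBk (Or.inr (Set.subset_insert x A'))
  · intro h
    clear hT hTk
    induction h with
    | refl => exact .refl
    | @tail A B _ hstep ih =>
      obtain ⟨hA, hB, hAk, hBk, -, hBA, hAB⟩ := hstep
      have hU : (A ∪ B).ncard ≤ k := by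
        have := Set.ncard_sdiff_add_ncard A B
        omega
      have hUD : Dominating G (A ∪ B) := hA.mono Set.subset_union_left
      refine (ih.tail ⟨hA, hUD, by omega, hU, tarMove_union_right hBA⟩).tail
        ⟨hUD, hB, hU, by omega, ?_⟩
      rw [Set.union_comm]
      exact (tarMove_union_right hAB).symm
end
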